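/- (Localized derivation inequality.) Let (X,d,μ) be a complete doubling metric measure space and let D be a derivation on (X,d,μ) with bound constant C(D). Then for every bounded Lipschitz function f : X → ℝ there is a μ-null set Ω_f such that |Df(x)| ≤ C(D)·Lip f(x) for every x ∉ Ω_f. -/

import Mathlib

open MeasureTheory Metric Filter Set Topology
open scoped ENNReal NNReal

noncomputable section

/-- `f` is a bounded Lipschitz function. -/
def IsBddLipschitz {X : Type*} [PseudoMetricSpace X] (f : X → ℝ) : Prop :=
  (∃ K : ℝ≥0, LipschitzWith K f) ∧ ∃ M : ℝ, ∀ x, |f x| ≤ M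

/-- The global Lipschitz constant of `f`. -/
def glip {X : Type*} [PseudoMetricSpace X] (f : X → ℝ) : ℝ :=
  sInf {K : ℝ | 0 ≤ K ∧ ∀ x y, |f x - f y| ≤ K * dist x y}

/-- `max (sup_X |f|) (global Lipschitz constant of f)`. -/
def lipNorm {X : Type*} [PseudoMetricSpace X] (f : X → ℝ) : ℝ :=
  max (⨆ x, |f x|) (glip f)

/-- The variation of `f` on the open ball `B(x,r)`:
`varlip f x r = r⁻¹ · sup_{y ∈ B(x,r)} |f x - f y|`. -/
def varlip {X : Type*} [PseudoMetricSpace X] (f : X → ℝ) (x : X) (r : ℝ) : ℝ :=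
  r⁻¹ * sSup ((fun y => |f x - f y|) '' ball x r)

/-- The upper variation of `f` at `x` from scale `r` down to `0`:
`Lip f (x,r) = sup_{0 < s ≤ r} varlip f x s`. -/
def bigLipR {X : Type*} [PseudoMetricSpace X] (f : X → ℝ) (x : X) (r : ℝ) : ℝ :=
  ⨆ s : Ioc (0:ℝ) r, varlip f x s.1

/-- The lower variation of `f` at `x` from scale `r` down to `0`:
`lip f (x,r) = inf_{0 < s ≤ r} varlip f x s`. -/
def smlLipR {X : Type*} [PseudoMetricSpace X] (f : X → ℝ) (x : X) (r : ℝ) : ℝ :=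
  ⨅ s : Ioc (0:ℝ) r, varlip f x s.1

/-- The pointwise upper Lipschitz constant
`Lip f (x) = inf_{r>0} sup_{0<s≤r} varlip f x s`. -/
def bigLip {X : Type*} [PseudoMetricSpace X] (f : X → ℝ) (x : X) : ℝ :=
  ⨅ r : Ioi (0:ℝ), bigLipR f x r.1

/-- The pointwise lower Lipschitz constant
`lip f (x) = sup_{r>0} inf_{0<s≤r} varlip f x s`. -/
def smlLip {X : Type*} [PseudoMetricSpace X] (f : X → ℝ) (x : X) : ℝ :=
  ⨆ r : Ioi (0:ℝ), smlLipR f x r.1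

/-- A derivation on the metric measure space `(X,d,μ)`: a linear, bounded operator
from bounded Lipschitz functions to measurable essentially bounded functions that
satisfies the Leibniz rule and is weak* sequentially continuous. -/
structure MDerivation (X : Type*) [PseudoMetricSpace X] [MeasurableSpace X]
    (μ : MeasureTheory.Measure X) where
  D : (X → ℝ) → (X → ℝ)
  C : ℝ
  C_nonneg : 0 ≤ C
  measurable_D : ∀ f, IsBddLipschitz f → Measurable (D f)
  linear : ∀ (a b : ℝ) (f g : X → ℝ), IsBddLipschitz f → IsBddLipschitz g →
      ∀ᵐ x ∂μ, D (fun y => a * f y + b * g y) x = a * D f x + b * D g x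
  bound : ∀ f, IsBddLipschitz f → ∀ᵐ x ∂μ, |D f x| ≤ C * lipNorm f
  leibniz : ∀ f g, IsBddLipschitz f → IsBddLipschitz g →
      ∀ᵐ x ∂μ, D (fun y => f y * g y) x = f x * D g x + g x * D f x
  weakStar : ∀ (F : ℕ → X → ℝ) (f : X → ℝ), (∀ n, IsBddLipschitz (F n)) →
      IsBddLipschitz f → (∃ B : ℝ, ∀ n, lipNorm (F n) ≤ B) →
      (∀ x, Tendsto (fun n => F n x) atTop (𝓝 (f x))) →
      ∀ g : X → ℝ, Integrable g μ →
        Tendsto (fun n => ∫ x, D (F n) x * g x ∂μ) atTop (𝓝 (∫ x, D f x * g x ∂μ))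

section BoundedLipschitz

variable {X : Type*} [PseudoMetricSpace X]

lemma LipschitzWith.isBddLipschitz {f : X → ℝ} {K : ℝ≥0} (hf : LipschitzWith K f) {M : ℝ}
    (hM : ∀ x, |f x| ≤ M) : IsBddLipschitz f :=
  ⟨⟨K, hf⟩, M, hM⟩

lemma glip_le_of_lipschitzWith {f : X → ℝ} {K : ℝ≥0} (hf : LipschitzWith K f) : glip f ≤ K :=
  csInf_le ⟨0, fun _ hk => hk.1⟩ ⟨K.2, fun x y => by simpa [Real.dist_eq] using hf.dist_le_mul x y⟩

lemma lipNorm_le_of_lipschitzWith {f : X → ℝ} {K : ℝ≥0} (hf : LipschitzWith K f) {M : ℝ}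
    (h0 : 0 ≤ M) (hM : ∀ x, |f x| ≤ M) : lipNorm f ≤ max M K :=
  max_le_max (Real.iSup_le hM h0) (glip_le_of_lipschitzWith hf)

lemma IsBddLipschitz.linearCombination {f g : X → ℝ} (hf : IsBddLipschitz f)
    (hg : IsBddLipschitz g) (a b : ℝ) : IsBddLipschitz fun x => a * f x + b * g x := by
  obtain ⟨⟨K, hK⟩, M, hM⟩ := hf
  obtain ⟨⟨L, hL⟩, N, hN⟩ := hg
  have hlip : LipschitzWith (‖a‖₊ * K + ‖b‖₊ * L) fun x => a * f x + b * g x :=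
    ((lipschitzWith_smul a).comp hK).add ((lipschitzWith_smul b).comp hL)
  refine hlip.isBddLipschitz (M := |a| * M + |b| * N) fun x => ?_
  refine (abs_add_le _ _).trans ?_
  rw [abs_mul, abs_mul]
  gcongr
  exacts [hM x, hN x]

lemma isBddLipschitz_const (c : ℝ) : IsBddLipschitz fun _ : X => c :=
  (LipschitzWith.const c).isBddLipschitz fun _ => le_rfl

/-- The functions `t ↦ t * min 1 (n * |t|)`, which vanish to second order at `0`, are Lipschitz
uniformly in `n`. -/
lemma lipschitzWith_mul_min (n : ℕ) : LipschitzWith 2 fun t : ℝ => t * min 1 (n * |t|) := by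
  have hn : (0 : ℝ) ≤ n := n.cast_nonneg
  have hmin0 : ∀ t : ℝ, 0 ≤ min 1 (n * |t|) := fun t => le_min zero_le_one (by positivity)
  have hdiff : ∀ t s : ℝ, |min 1 (n * |t|) - min 1 (n * |s|)| ≤ n * |t - s| := fun t s => by
    refine (abs_min_sub_min_le_max 1 _ 1 _).trans ?_
    rw [sub_self, abs_zero, max_eq_right (abs_nonneg _), ← mul_sub, abs_mul, abs_of_nonneg hn]
    exact mul_le_mul_of_nonneg_left (abs_abs_sub_abs_le _ _) hn
  have hsmall : ∀ t s : ℝ, n * |s| ≤ 1 →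
      |t * min 1 (n * |t|) - s * min 1 (n * |s|)| ≤ 2 * |t - s| := fun t s hs => by
    have h1 : |(t - s) * min 1 (n * |t|)| ≤ |t - s| := by
      rw [abs_mul, abs_of_nonneg (hmin0 t)]
      exact mul_le_of_le_one_right (abs_nonneg _) (min_le_left _ _)
    have h2 : |s * (min 1 (n * |t|) - min 1 (n * |s|))| ≤ |t - s| := by
      rw [abs_mul]
      calc |s| * _ ≤ |s| * (n * |t - s|) := mul_le_mul_of_nonneg_left (hdiff t s) (abs_nonneg _)
        _ = (n * |s|) * |t - s| := by ring
        _ ≤ |t - s| := mul_le_of_le_one_left (abs_nonneg _) hs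
    calc _ = |(t - s) * min 1 (n * |t|) + s * (min 1 (n * |t|) - min 1 (n * |s|))| := by ring_nf
      _ ≤ _ := abs_add_le _ _
      _ ≤ 2 * |t - s| := by linarith
  refine LipschitzWith.of_dist_le_mul fun t s => ?_
  rw [Real.dist_eq, Real.dist_eq, NNReal.coe_ofNat]
  rcases le_total (n * |s|) 1 with hs | hs
  · exact hsmall t s hs
  rcases le_total (n * |t|) 1 with ht | ht
  · rw [abs_sub_comm, abs_sub_comm t s]
    exact hsmall s t ht
  · rw [min_eq_left hs, min_eq_left ht, mul_one, mul_one]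
    linarith [abs_nonneg (t - s)]

lemma tendsto_mul_min (t : ℝ) :
    Tendsto (fun n : ℕ => t * min 1 (n * |t|)) atTop (𝓝 t) := by
  rcases eq_or_ne t 0 with rfl | ht
  · simp
  have hlim : Tendsto (fun n : ℕ => (n : ℝ) * |t|) atTop atTop :=
    tendsto_natCast_atTop_atTop.atTop_mul_const (abs_pos.2 ht)
  refine tendsto_const_nhds.congr' ?_
  filter_upwards [hlim.eventually_ge_atTop 1] with n hn
  rw [min_eq_left hn, mul_one]

end BoundedLipschitz

section Variation

variable {X : Type*} [PseudoMetricSpace X]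

lemma varlip_le_of_lipschitzWith {f : X → ℝ} {K : ℝ≥0} (hf : LipschitzWith K f) (x : X) {s : ℝ}
    (hs : 0 < s) : varlip f x s ≤ K := by
  rw [varlip, inv_mul_le_iff₀ hs]
  refine Real.sSup_le ?_ (by positivity)
  rintro _ ⟨y, hy, rfl⟩
  calc |f x - f y| ≤ K * dist x y := hf.dist_le_mul x y
    _ ≤ K * s := by gcongr; exact (mem_ball'.1 hy).le
    _ = s * K := mul_comm _ _

lemma varlip_nonneg (f : X → ℝ) (x : X) {s : ℝ} (hs : 0 < s) : 0 ≤ varlip f x s := by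
  refine mul_nonneg (inv_nonneg.2 hs.le) (Real.sSup_nonneg ?_)
  rintro _ ⟨y, -, rfl⟩
  exact abs_nonneg _

lemma bddAbove_range_varlip {f : X → ℝ} {K : ℝ≥0} (hf : LipschitzWith K f) (x : X) (r : ℝ) :
    BddAbove (range fun s : Ioc (0 : ℝ) r => varlip f x s.1) :=
  ⟨K, by rintro _ ⟨s, rfl⟩; exact varlip_le_of_lipschitzWith hf x s.2.1⟩

lemma varlip_le_bigLipR {f : X → ℝ} {K : ℝ≥0} (hf : LipschitzWith K f) (x : X) {s r : ℝ}
    (hs : 0 < s) (hsr : s ≤ r) : varlip f x s ≤ bigLipR f x r :=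
  le_ciSup (bddAbove_range_varlip hf x r) ⟨s, hs, hsr⟩

lemma bigLipR_nonneg (f : X → ℝ) (x : X) (r : ℝ) : 0 ≤ bigLipR f x r :=
  Real.iSup_nonneg fun s => varlip_nonneg f x s.2.1

lemma bigLipR_mono {f : X → ℝ} {K : ℝ≥0} (hf : LipschitzWith K f) (x : X) {r s : ℝ}
    (hrs : r ≤ s) : bigLipR f x r ≤ bigLipR f x s :=
  Real.iSup_le (fun t => varlip_le_bigLipR hf x t.2.1 (t.2.2.trans hrs)) (bigLipR_nonneg f x s)

/-- At distances below `r`, the increments of `f` from `x` are controlled by `bigLipR f x r`. -/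
lemma abs_sub_le_bigLipR_mul_dist {f : X → ℝ} {K : ℝ≥0} (hf : LipschitzWith K f) {x y : X} {r : ℝ}
    (hxy : dist x y < r) : |f x - f y| ≤ bigLipR f x r * dist x y := by
  have key : ∀ s ∈ Ioo (dist x y) r, |f x - f y| ≤ bigLipR f x r * s := fun s hs => by
    have hs0 : 0 < s := dist_nonneg.trans_lt hs.1
    have hbdd : BddAbove ((fun y => |f x - f y|) '' ball x s) := by
      refine ⟨K * s, ?_⟩
      rintro _ ⟨z, hz, rfl⟩
      calc |f x - f z| ≤ K * dist x z := hf.dist_le_mul x z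
        _ ≤ K * s := by gcongr; exact (mem_ball'.1 hz).le
    have h := varlip_le_bigLipR hf x hs0 hs.2.le
    rw [varlip, inv_mul_le_iff₀ hs0, mul_comm] at h
    exact (le_csSup hbdd ⟨y, mem_ball'.2 hs.1, rfl⟩).trans h
  have hlim : Tendsto (fun s => bigLipR f x r * s) (𝓝[>] dist x y) (𝓝 (bigLipR f x r * dist x y)) :=
    ((continuous_const.mul continuous_id).tendsto _).mono_left nhdsWithin_le_nhds
  exact ge_of_tendsto hlim (eventually_of_mem (Ioo_mem_nhdsGT hxy) key)

end Variation

section Separability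

variable {X : Type*} [PseudoMetricSpace X] [MeasurableSpace X]

lemma sigmaFinite_of_measure_ball_lt_top {μ : Measure X} [OpensMeasurableSpace X]
    (hfin : ∀ (x : X) (r : ℝ), 0 < r → μ (ball x r) < ⊤) : SigmaFinite μ := by
  rcases isEmpty_or_nonempty X with hX | ⟨⟨x₀⟩⟩
  · rw [Measure.eq_zero_of_isEmpty μ]
    infer_instance
  refine ⟨⟨⟨fun n : ℕ => ball x₀ (n + 1), fun _ => mem_univ _,
    fun n => hfin x₀ _ (by positivity), ?_⟩⟩⟩
  refine eq_univ_of_forall fun x => mem_iUnion.2 ?_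
  obtain ⟨n, hn⟩ := exists_nat_gt (dist x x₀)
  exact ⟨n, mem_ball.2 (hn.trans (lt_add_one _))⟩

lemma secondCountableTopology_of_measure_ball_pos (μ : Measure X) [OpensMeasurableSpace X]
    [SFinite μ] (hpos : ∀ (x : X) (r : ℝ), 0 < r → 0 < μ (ball x r)) :
    SecondCountableTopology X := by
  refine Metric.secondCountable_of_almost_dense_set fun ε hε => ?_
  obtain ⟨u, -, hdisj, hcov⟩ := Vitali.exists_disjoint_subfamily_covering_enlargement_ball
    (univ : Set X) id (fun _ => ε / 5) (ε / 5) (fun _ _ => le_rfl) 5 (by norm_num)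
  refine ⟨u, ?_, fun x => ?_⟩
  · have h := Measure.countable_meas_pos_of_disjoint_iUnion (μ := μ)
      (As := fun a : u => ball (a : X) (ε / 5)) (fun _ => measurableSet_ball)
      (fun a b hab => hdisj a.2 b.2 (Subtype.coe_injective.ne hab))
    simp only [hpos _ _ (by positivity : (0 : ℝ) < ε / 5), ofPred_true] at h
    exact countable_coe_iff.1 (countable_univ_iff.1 h)
  · obtain ⟨b, hb, hsub⟩ := hcov x (mem_univ x)
    have hx := hsub (mem_ball_self (by positivity))
    exact ⟨b, hb, by simpa [mul_div_cancel₀] using (mem_ball.1 hx).le⟩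

end Separability

namespace MDerivation

variable {X : Type*} [PseudoMetricSpace X] [MeasurableSpace X] {μ : Measure X}

lemma ae_const_eq_zero (D : MDerivation X μ) (c : ℝ) : ∀ᵐ x ∂μ, D.D (fun _ => c) x = 0 := by
  have h1 := D.leibniz _ _ (isBddLipschitz_const 1) (isBddLipschitz_const 1)
  have h2 := D.linear c 0 _ _ (isBddLipschitz_const 1) (isBddLipschitz_const 1)
  filter_upwards [h1, h2] with x hx1 hx2
  simp only [one_mul, mul_one, zero_mul, add_zero] at hx1 hx2
  rw [hx2, show D.D (fun _ => 1) x = 0 by linarith, mul_zero]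

/-- Locality: `D f` vanishes almost everywhere on the zero set of `f`. -/
lemma ae_eq_zero_of_eq_zero [OpensMeasurableSpace X] [SigmaFinite μ] (D : MDerivation X μ)
    {f : X → ℝ} (hf : IsBddLipschitz f) : ∀ᵐ x ∂μ, f x = 0 → D.D f x = 0 := by
  obtain ⟨⟨K, hK⟩, M, hM⟩ := id hf
  set g : ℕ → X → ℝ := fun n x => min 1 (n * |f x|)
  have hg : ∀ n, IsBddLipschitz (g n) := fun n => by
    have hlip : LipschitzWith (‖(n : ℝ)‖₊ * (1 * K)) fun x => (n : ℝ) * |f x| :=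
      (lipschitzWith_smul (n : ℝ)).comp (lipschitzWith_one_norm.comp hK)
    refine (hlip.const_min 1).isBddLipschitz (M := 1) fun x => ?_
    rw [abs_of_nonneg (le_min zero_le_one (by positivity))]
    exact min_le_left _ _
  have hFlip : ∀ n, LipschitzWith (2 * K) fun x => f x * g n x := fun n =>
    (lipschitzWith_mul_min n).comp hK
  have hFbdd : ∀ n x, |f x * g n x| ≤ |M| := fun n x => by
    rw [abs_mul, abs_of_nonneg (le_min zero_le_one (by positivity) : 0 ≤ g n x)]
    exact (mul_le_of_le_one_right (abs_nonneg _) (min_le_left _ _)).trans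
      ((hM x).trans (le_abs_self M))
  have hZ : MeasurableSet {x | f x = 0} := (isClosed_singleton.preimage hK.continuous).measurableSet
  have hDF : ∀ n, ∀ᵐ x ∂μ, f x = 0 → D.D (fun y => f y * g n y) x = 0 := fun n => by
    filter_upwards [D.leibniz f (g n) hf (hg n)] with x hx h0
    simp [hx, h0, g]
  have hzero : {x | f x = 0}.indicator (D.D f) =ᵐ[μ] 0 := by
    refine ae_eq_zero_of_forall_setIntegral_eq_of_sigmaFinite (fun s hs hμs => ?_)
      fun s hs hμs => ?_
    · refine IntegrableOn.indicator ?_ hZ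
      refine Measure.integrableOn_of_bounded hμs.ne (D.measurable_D f hf).aestronglyMeasurable
        (M := D.C * lipNorm f) (ae_restrict_of_ae ?_)
      exact D.bound f hf
    · set h : X → ℝ := ({x | f x = 0} ∩ s).indicator 1
      have hint : Integrable h μ :=
        (integrable_indicator_iff (hZ.inter hs)).2 <|
          integrableOn_const (ne_top_of_le_ne_top hμs.ne (measure_mono inter_subset_right))
      have hlim := D.weakStar (fun n x => f x * g n x) f
        (fun n => (hFlip n).isBddLipschitz (hFbdd n)) hf
        ⟨_, fun n => lipNorm_le_of_lipschitzWith (hFlip n) (abs_nonneg M) (hFbdd n)⟩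
        (fun x => tendsto_mul_min (f x)) h hint
      have hn : ∀ n, ∫ x, D.D (fun y => f y * g n y) x * h x ∂μ = 0 := fun n => by
        refine integral_eq_zero_of_ae ?_
        filter_upwards [hDF n] with x hx
        by_cases hxs : x ∈ {x | f x = 0} ∩ s
        · simp [hx hxs.1]
        · simp [h, hxs]
      simp only [hn] at hlim
      refine Eq.trans ?_ (tendsto_nhds_unique hlim tendsto_const_nhds)
      rw [← integral_indicator hs, indicator_indicator]
      congr 1 with x
      by_cases hxs : x ∈ {x | f x = 0} ∩ s
      · rw [indicator_of_mem (inter_comm _ s ▸ hxs)]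
        simp [h, hxs.1, hxs.2]
      · rw [indicator_of_notMem (inter_comm _ s ▸ hxs)]
        simp [h, hxs]
  filter_upwards [hzero] with x hx h0
  rwa [indicator_of_mem (by exact h0)] at hx

/-- Two bounded Lipschitz functions have the same derivative almost everywhere on the set where
they differ by a given constant. -/
lemma ae_eq_of_eq_sub_const [OpensMeasurableSpace X] [SigmaFinite μ] (D : MDerivation X μ)
    {f g : X → ℝ} (hf : IsBddLipschitz f) (hg : IsBddLipschitz g) (c : ℝ) :
    ∀ᵐ x ∂μ, g x = f x - c → D.D f x = D.D g x := by
  have hfg := hf.linearCombination hg 1 (-1)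
  have hloc := D.ae_eq_zero_of_eq_zero (hfg.linearCombination (isBddLipschitz_const c) 1 (-1))
  filter_upwards [hloc, D.linear 1 (-1) _ _ hfg (isBddLipschitz_const c), D.linear 1 (-1) _ _ hf hg,
    D.ae_const_eq_zero c] with x h1 h2 h3 h4 hx
  have h5 := h1 (by rw [hx]; ring)
  rw [h2, h3, h4] at h5
  linarith

/-- If `f` is `K`-Lipschitz on a set of diameter at most one, then `|D f| ≤ C K` almost everywhere
on this set. -/
lemma ae_abs_le_of_lipschitzOnWith [OpensMeasurableSpace X] [SigmaFinite μ] (D : MDerivation X μ)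
    {f : X → ℝ} (hf : IsBddLipschitz f) {K : ℝ≥0} {A : Set X} (hA : LipschitzOnWith K f A)
    (hdiam : ∀ x ∈ A, ∀ y ∈ A, dist x y ≤ 1) : ∀ᵐ x ∂μ, x ∈ A → |D.D f x| ≤ D.C * K := by
  rcases A.eq_empty_or_nonempty with rfl | ⟨p, hp⟩
  · simp
  obtain ⟨g, hg, hfg⟩ := hA.extend_real
  set k : X → ℝ := fun x => max (-(K : ℝ)) (min K (g x - f p))
  have hk : LipschitzWith K k := by
    have hsub : LipschitzWith K fun x => g x - f p :=
      LipschitzWith.of_dist_le_mul fun x y => by simpa using hg.dist_le_mul x y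
    exact (hsub.const_min _).const_max _
  have hkbdd : ∀ x, |k x| ≤ K := fun x =>
    abs_le.2 ⟨le_max_left _ _, max_le (by linarith [K.2]) (min_le_left _ _)⟩
  have hkA : ∀ x ∈ A, k x = f x - f p := fun x hx => by
    have h := (hA.dist_le_mul x hx p hp).trans
      (mul_le_of_le_one_right K.2 (hdiam x hx p hp))
    rw [Real.dist_eq, abs_le] at h
    simp only [k, ← hfg hx, min_eq_right h.2, max_eq_right h.1]
  have hkL := hk.isBddLipschitz hkbdd
  filter_upwards [D.ae_eq_of_eq_sub_const hf hkL (f p), D.bound k hkL] with x h1 h2 hx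
  rw [h1 (hkA x hx)]
  refine h2.trans (mul_le_mul_of_nonneg_left ?_ D.C_nonneg)
  simpa using lipNorm_le_of_lipschitzWith hk K.2 hkbdd

/-- The pointwise bound of a derivation by the upper Lipschitz constant holds almost everywhere for
every `σ`-finite measure on a second countable space. -/
theorem ae_abs_le_mul_bigLip [OpensMeasurableSpace X] [SecondCountableTopology X] [SigmaFinite μ]
    (D : MDerivation X μ) {f : X → ℝ} (hf : IsBddLipschitz f) :
    ∀ᵐ x ∂μ, |D.D f x| ≤ D.C * bigLip f x := by
  rcases isEmpty_or_nonempty X with hX | hX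
  · exact ae_of_all _ fun x => hX.elim x
  obtain ⟨K, hK⟩ := hf.1
  let A : ℕ → ℚ → ℕ → Set X := fun n q m =>
    {x | bigLipR f x (1 / (n + 1)) ≤ q} ∩
      ball (TopologicalSpace.denseSeq X m) (1 / (n + 1) / 2)
  have hdist : ∀ n q m, ∀ x ∈ A n q m, ∀ y ∈ A n q m, dist x y < 1 / ((n : ℝ) + 1) :=
    fun n q m x hx y hy => by
      have h := dist_triangle_right x y (TopologicalSpace.denseSeq X m)
      linarith [mem_ball.1 hx.2, mem_ball.1 hy.2]
  have hA : ∀ n q m, ∀ᵐ x ∂μ, x ∈ A n q m → |D.D f x| ≤ D.C * (q : ℝ) := fun n q m => by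
    rcases lt_or_ge q 0 with hq | hq
    · refine ae_of_all _ fun x hx => absurd (bigLipR_nonneg f x (1 / (n + 1))) (not_le.2 ?_)
      exact lt_of_le_of_lt hx.1 (by exact_mod_cast hq)
    have hq' : (0 : ℝ) ≤ q := by exact_mod_cast hq
    refine D.ae_abs_le_of_lipschitzOnWith hf (K := ⟨q, hq'⟩)
      (LipschitzOnWith.of_dist_le_mul fun x hx y hy => ?_) fun x hx y hy => ?_
    · exact (abs_sub_le_bigLipR_mul_dist hK (hdist n q m x hx y hy)).trans
        (mul_le_mul_of_nonneg_right hx.1 dist_nonneg)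
    · refine (hdist n q m x hx y hy).le.trans ?_
      rw [div_le_one (by positivity)]
      linarith [(n.cast_nonneg : (0 : ℝ) ≤ n)]
  filter_upwards [ae_all_iff.2 fun n => ae_all_iff.2 fun q => ae_all_iff.2 (hA n q)] with x hx
  have hq : ∀ q : ℚ, bigLip f x < q → |D.D f x| ≤ D.C * (q : ℝ) := fun q hq => by
    obtain ⟨⟨r, hr⟩, hrq⟩ := exists_lt_of_ciInf_lt hq
    obtain ⟨n, hn⟩ := exists_nat_one_div_lt (mem_Ioi.1 hr)
    obtain ⟨m, hm⟩ := (TopologicalSpace.denseRange_denseSeq X).exists_dist_lt x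
      (by positivity : (0 : ℝ) < 1 / (n + 1) / 2)
    exact hx n q m ⟨(bigLipR_mono hK x hn.le).trans hrq.le, mem_ball.2 hm⟩
  by_contra! hlt
  have hlim : Tendsto (fun t => D.C * t) (𝓝[>] bigLip f x) (𝓝 (D.C * bigLip f x)) :=
    ((continuous_const.mul continuous_id).tendsto _).mono_left nhdsWithin_le_nhds
  obtain ⟨t, ht, htx⟩ := ((hlim.eventually_lt_const hlt).and self_mem_nhdsWithin).exists
  obtain ⟨q, hq1, hq2⟩ := exists_rat_btwn (show bigLip f x < t from htx)
  exact absurd ((hq q hq1).trans (mul_le_mul_of_nonneg_left hq2.le D.C_nonneg)) (not_le.2 ht)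

end MDerivation

theorem stmt_7 {X : Type*} [MetricSpace X] [CompleteSpace X]
    [MeasurableSpace X] [BorelSpace X] (μ : Measure X) (hμ : μ ≠ 0)
    (hpos : ∀ (x : X) (r : ℝ), 0 < r → 0 < μ (ball x r))
    (hfin : ∀ (x : X) (r : ℝ), 0 < r → μ (ball x r) < ⊤)
    (CD : ℝ≥0∞) (hCD : 1 ≤ CD)
    (hdoub : ∀ (x : X) (r : ℝ), 0 < r → μ (ball x (2 * r)) ≤ CD * μ (ball x r))
    (D : MDerivation X μ) (f : X → ℝ) (hf : IsBddLipschitz f) :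
    ∃ Ω : Set X, μ Ω = 0 ∧ ∀ x ∉ Ω, |D.D f x| ≤ D.C * bigLip f x := by
  have : SigmaFinite μ := sigmaFinite_of_measure_ball_lt_top hfin
  have : SecondCountableTopology X := secondCountableTopology_of_measure_ball_pos μ hpos
  exact ⟨{x | ¬ |D.D f x| ≤ D.C * bigLip f x}, ae_iff.1 (D.ae_abs_le_mul_bigLip hf),
    fun _ hx => not_not.1 hx⟩
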